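/- arXiv:1108.0049 — 2 statements merged into one kernel-verified Lean document; each statement's English description precedes it below -/
import Mathlib

section
/- Let H be a complex Hilbert space and let (P_α)_{α∈A} be a net of orthogonal projections in B(H) converging to the identity in the *-strong operator topology. Then for every unitary operator U ∈ B(H) there exists a family (U_α)_{α∈A} of operators with U_α* U_α = U_α U_α* = P_α for every α, such that U_α → U and U_α* → U* in the strong operator topology (i.e. (U_α) converges to U in the *-strong operator topology). -/
/- STATEMENT 1: Lemma 1 part (5): every unitary on `H` is the *-SOT limit of a family of
unitaries of the corners `Pα B(H) Pα`. -/

open Filter Topology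

/-- A net (indexed by a directed set `ι`) of operators converges in the *-strong operator
topology to `T₀`. -/
def SOTStarTendsto {H : Type*} [NormedAddCommGroup H] [InnerProductSpace ℂ H]
    [CompleteSpace H] {ι : Type*} [Preorder ι] (T : ι → H →L[ℂ] H) (T₀ : H →L[ℂ] H) : Prop :=
  ∀ x : H, Tendsto (fun i => T i x) atTop (𝓝 (T₀ x)) ∧
    Tendsto (fun i => star (T i) x) atTop (𝓝 (star T₀ x))

/-- The orthogonal projection onto `ker S`: it fixes every operator whose range lies in `ker S`. -/
theorem exists_projection_onto_ker {H : Type*} [NormedAddCommGroup H] [InnerProductSpace ℂ H]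
    [CompleteSpace H] (S : H →L[ℂ] H) :
    ∃ Q : H →L[ℂ] H, IsSelfAdjoint Q ∧ Q * Q = Q ∧ S * Q = 0 ∧
      ∀ T : H →L[ℂ] H, S * T = 0 → Q * T = T := by
  have : CompleteSpace (LinearMap.ker (S : H →ₗ[ℂ] H)) :=
    (ContinuousLinearMap.isClosed_ker S).completeSpace_coe
  let K := LinearMap.ker (S : H →ₗ[ℂ] H)
  refine ⟨K.starProjection, isSelfAdjoint_starProjection K,
    K.isIdempotentElem_starProjection, ?_, ?_⟩
  · ext x
    exact K.starProjection_apply_mem x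
  · intro T hT
    ext x
    exact Submodule.starProjection_eq_self_iff.2 (DFunLike.congr_fun hT x)

/-- Every unitary operator has a bounded skew-adjoint logarithm. -/
theorem exists_skewAdjoint_exp_eq {H : Type*} [NormedAddCommGroup H] [InnerProductSpace ℂ H]
    [CompleteSpace H] (U : H →L[ℂ] H) (hU : U ∈ unitary (H →L[ℂ] H)) :
    ∃ A : H →L[ℂ] H, star A = -A ∧ NormedSpace.exp A = U := by
  have hn : IsStarNormal U := ⟨by rw [Commute, SemiconjBy, hU.1, hU.2]⟩
  have hcirc : ∀ z ∈ spectrum ℂ U, ‖z‖ = 1 := fun z hz => by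
    simpa using Unitary.spectrum_subset_circle ⟨U, hU⟩ hz
  let b : ℂ → ℂ := fun z => Complex.I * (Real.arccos z.re : ℂ)
  let s : ℂ → ℂ := fun z => ((max z.im 0 : ℝ) : ℂ)
  have hb : Continuous b := by
    have := Real.continuous_arccos
    fun_prop
  have hs : Continuous s := by fun_prop
  have hexp : ∀ z ∈ spectrum ℂ U, Complex.exp (b z) = z.re + |z.im| * Complex.I := by
    intro z hz
    have h1 : z.re ^ 2 + z.im ^ 2 = 1 := by
      have := Complex.sq_norm z
      rw [hcirc z hz, Complex.normSq_apply] at this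
      nlinarith
    have h2 : √(1 - z.re ^ 2) = |z.im| := by
      rw [← Real.sqrt_sq_eq_abs]; congr 1; linarith
    have h3 : b z = (Real.arccos z.re : ℂ) * Complex.I := mul_comm _ _
    rw [h3, Complex.exp_mul_I, ← Complex.ofReal_cos, ← Complex.ofReal_sin, Real.sin_arccos, h2,
      Real.cos_arccos (by nlinarith) (by nlinarith)]
  let B : H →L[ℂ] H := cfc b U
  let S : H →L[ℂ] H := cfc s U
  have hBS : Commute B S := cfc_commute_cfc b s U
  have hBstar : star B = -B := by
    simp only [B]
    rw [← cfc_star, ← cfc_neg]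
    congr 1
    ext z
    simp [b]
  have hSstar : star S = S := by
    simp only [S]
    rw [← cfc_star]
    congr 1
    ext z
    simp [s]
  have hBn : IsStarNormal B := ⟨by rw [hBstar]; exact (Commute.refl B).neg_left⟩
  have hexpB : NormedSpace.exp B = cfc (fun z => Complex.exp (b z)) U := by
    rw [← CFC.complex_exp_eq_normedSpace_exp (a := B)]
    exact (cfc_comp' Complex.exp b U).symm
  have hexpnegB : NormedSpace.exp (-B) = cfc (fun z => star (Complex.exp (b z))) U := by
    rw [← hBstar, ← NormedSpace.star_exp, hexpB, ← cfc_star]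
  have hsub : ∀ f : ℂ → ℂ, Continuous f → cfc f U - U = cfc (fun z => f z - z) U := by
    intro f hf
    rw [cfc_sub f (fun z => z) U, cfc_id' ℂ U]
  have hWS : S * (NormedSpace.exp B - U) = 0 := by
    rw [hexpB, hsub _ (by fun_prop), ← cfc_mul .., ← cfc_zero ℂ U]
    refine cfc_congr fun z hz => ?_
    simp only [hexp z hz, s]
    rcases le_total z.im 0 with h | h
    · simp [h]
    · apply Complex.ext <;> simp [abs_of_nonneg h]
  have hWstar : NormedSpace.exp (-B) - U = (-2 * Complex.I) • S := by
    rw [hexpnegB, hsub _ (by fun_prop), ← cfc_smul ..]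
    refine cfc_congr fun z hz => ?_
    simp only [hexp z hz, s]
    rcases le_total z.im 0 with h | h
    · apply Complex.ext <;> simp [abs_of_nonpos h, h]
    · apply Complex.ext <;> simp [abs_of_nonneg h, h]; ring
  obtain ⟨Q, hQ, hQQ, hSQ, hker⟩ := exists_projection_onto_ker S
  have hQS : Q * S = 0 := by
    have := congrArg star hSQ
    rwa [star_mul, hQ.star_eq, hSstar, star_zero] at this
  have hQBQ : Q * (B * Q) = B * Q := hker _ (by rw [← mul_assoc, ← hBS.eq, mul_assoc, hSQ, mul_zero])
  have hQB : Q * B = B * Q := by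
    have := congrArg star hQBQ
    simp only [star_mul, hQ.star_eq, hBstar, mul_neg, neg_mul, neg_inj] at this
    rw [← this, mul_assoc, hQBQ]
  let A : H →L[ℂ] H := B - 2 * (Q * B)
  have hAQ : A * Q = -(B * Q) := by
    simp only [A, sub_mul, mul_assoc, hQBQ]
    noncomm_ring
  have hneg : SemiconjBy Q (-B) A := by
    rw [SemiconjBy, hAQ, mul_neg, hQB]
  have hpos : SemiconjBy (1 - Q) B A := by
    rw [SemiconjBy, mul_sub, mul_one, hAQ, sub_mul, one_mul, hQB]
    simp only [A, hQB]
    noncomm_ring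
  let : NormedAlgebra ℚ (H →L[ℂ] H) := NormedAlgebra.restrictScalars ℚ ℂ _
  refine ⟨A, ?_, ?_⟩
  · simp only [A, star_sub, star_mul, hBstar, hQ.star_eq, star_ofNat, hQB]
    noncomm_ring
    rw [hQB]
  · have h1 := hneg.exp_right.eq
    have h2 := hpos.exp_right.eq
    have h3 : Q * NormedSpace.exp (-B) = Q * U := by
      rw [← sub_eq_zero, ← mul_sub, hWstar, mul_smul_comm, hQS, smul_zero]
    have h4 : (1 - Q) * NormedSpace.exp B = (1 - Q) * U := by
      rw [← sub_eq_zero, ← mul_sub, sub_mul, one_mul, hker _ hWS, sub_self]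
    calc NormedSpace.exp A = NormedSpace.exp A * Q + NormedSpace.exp A * (1 - Q) := by
          rw [← mul_add, add_sub_cancel, mul_one]
      _ = Q * U + (1 - Q) * U := by rw [← h1, ← h2, h3, h4]
      _ = U := by rw [← add_mul, add_sub_cancel, one_mul]

/-- Joint continuity of evaluation along uniformly bounded, strongly convergent families. -/
theorem tendsto_apply_of_norm_le {H : Type*} [NormedAddCommGroup H] [NormedSpace ℂ H]
    {ι : Type*} {l : Filter ι} {T : ι → H →L[ℂ] H} {T₀ : H →L[ℂ] H} {M : ℝ}
    (hM : ∀ i, ‖T i‖ ≤ M) (hT : ∀ x, Tendsto (fun i => T i x) l (𝓝 (T₀ x)))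
    {y : ι → H} {y₀ : H} (hy : Tendsto y l (𝓝 y₀)) :
    Tendsto (fun i => T i (y i)) l (𝓝 (T₀ y₀)) := by
  have h0 : Tendsto (fun i => T i (y i - y₀)) l (𝓝 0) := by
    refine squeeze_zero_norm (a := fun i => M * ‖y i - y₀‖)
      (fun i => (T i).le_of_opNorm_le (hM i) _) ?_
    simpa using (tendsto_iff_norm_sub_tendsto_zero.1 hy).const_mul M
  simpa using h0.add (hT y₀)

/-- The exponential is strongly continuous on norm-bounded sets. -/
theorem tendsto_exp_apply_of_norm_le {H : Type*} [NormedAddCommGroup H] [NormedSpace ℂ H]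
    [CompleteSpace H] {ι : Type*} {l : Filter ι} {T : ι → H →L[ℂ] H} {T₀ : H →L[ℂ] H} {M : ℝ}
    (hM : ∀ i, ‖T i‖ ≤ M) (hT : ∀ x, Tendsto (fun i => T i x) l (𝓝 (T₀ x))) (x : H) :
    Tendsto (fun i => NormedSpace.exp (T i) x) l (𝓝 (NormedSpace.exp T₀ x)) := by
  have hpow : ∀ n : ℕ, Tendsto (fun i => (T i ^ n) x) l (𝓝 ((T₀ ^ n) x)) := by
    intro n
    induction n with
    | zero => simpa using tendsto_const_nhds
    | succ n ih =>
      simp only [pow_succ', mul_apply_eq_comp]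
      exact tendsto_apply_of_norm_le hM hT ih
  have happly : ∀ R : H →L[ℂ] H,
      NormedSpace.exp R x = ∑' n : ℕ, ((n.factorial : ℂ)⁻¹) • (R ^ n) x := fun R =>
    ((NormedSpace.exp_series_hasSum_exp' (𝕂 := ℂ) R).mapL
      (ContinuousLinearMap.apply ℂ H x)).tsum_eq.symm
  have hbound : ∀ (i : ι) (n : ℕ), ‖(T i ^ n) x‖ ≤ M ^ n * ‖x‖ := by
    intro i n
    induction n with
    | zero => simp
    | succ n ih =>
      rw [pow_succ', mul_apply_eq_comp, pow_succ', mul_assoc]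
      exact (T i).le_of_opNorm_le_of_le (hM i) ih
  simp only [happly]
  refine tendsto_tsum_of_dominated_convergence
    (bound := fun n => M ^ n / n.factorial * ‖x‖)
    ((Real.summable_pow_div_factorial M).mul_right _) (fun n => (hpow n).const_smul _) ?_
  refine Eventually.of_forall fun i n => ?_
  rw [norm_smul, norm_inv, Complex.norm_natCast, div_eq_inv_mul, mul_assoc]
  gcongr
  exact hbound i n

theorem stmt_1 {H : Type*} [NormedAddCommGroup H] [InnerProductSpace ℂ H] [CompleteSpace H]
    {ι : Type*} [SemilatticeSup ι] [Nonempty ι]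
    (P : ι → H →L[ℂ] H)
    (hPproj : ∀ i, IsSelfAdjoint (P i) ∧ P i * P i = P i)
    (hPlim : SOTStarTendsto P (1 : H →L[ℂ] H))
    (U : H →L[ℂ] H) (hU : star U * U = 1 ∧ U * star U = 1) :
    ∃ V : ι → H →L[ℂ] H,
      (∀ i, star (V i) * V i = P i ∧ V i * star (V i) = P i) ∧
      SOTStarTendsto V U := by
  let : NormedAlgebra ℚ (H →L[ℂ] H) := NormedAlgebra.restrictScalars ℚ ℂ _
  obtain ⟨A, hA, rfl⟩ := exists_skewAdjoint_exp_eq U hU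
  have hPnorm : ∀ i, ‖P i‖ ≤ 1 := fun i =>
    IsStarProjection.norm_le (P i) ⟨(hPproj i).2, (hPproj i).1⟩
  have hcompress : ∀ T : H →L[ℂ] H, ∀ x,
      Tendsto (fun i => P i (NormedSpace.exp (P i * T * P i) x)) atTop
        (𝓝 (NormedSpace.exp T x)) := by
    intro T x
    have hP : ∀ x, Tendsto (fun i => P i x) atTop (𝓝 ((1 : H →L[ℂ] H) x)) := fun x => (hPlim x).1
    refine tendsto_apply_of_norm_le hPnorm hP
      (tendsto_exp_apply_of_norm_le (M := ‖T‖) (fun i => ?_) (fun y => ?_) x)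
    · calc ‖P i * T * P i‖ ≤ ‖P i‖ * ‖T‖ * ‖P i‖ := norm_mul₃_le
        _ ≤ 1 * ‖T‖ * 1 := by gcongr <;> exact hPnorm i
        _ = ‖T‖ := by ring
    · exact tendsto_apply_of_norm_le hPnorm hP ((T.continuous.tendsto _).comp (hP y))
  have hcomm : ∀ i, ∀ T : H →L[ℂ] H, Commute (P i) (NormedSpace.exp (P i * T * P i)) := by
    intro i T
    refine Commute.exp_right ?_
    rw [Commute, SemiconjBy, mul_assoc _ (P i) (P i), (hPproj i).2, ← mul_assoc, ← mul_assoc,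
      (hPproj i).2]
  have hstar : ∀ i, star (P i * NormedSpace.exp (P i * A * P i)) =
      P i * NormedSpace.exp (P i * (-A) * P i) := by
    intro i
    rw [(hcomm i _).eq, star_mul, NormedSpace.star_exp, star_mul, star_mul, hA,
      (hPproj i).1.star_eq, mul_assoc (P i)]
  have hinv : ∀ i, ∀ T : H →L[ℂ] H, P i * NormedSpace.exp (P i * (-T) * P i) *
      (P i * NormedSpace.exp (P i * T * P i)) = P i := by
    intro i T
    rw [(hcomm i T).eq, ← mul_assoc, mul_assoc (P i), mul_neg, neg_mul,
      ← NormedSpace.exp_add_of_commute (Commute.refl _).neg_left, neg_add_cancel,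
      NormedSpace.exp_zero, mul_one, (hPproj i).2]
  refine ⟨fun i => P i * NormedSpace.exp (P i * A * P i), fun i => ⟨?_, ?_⟩, fun x => ⟨?_, ?_⟩⟩
  · rw [hstar, hinv]
  · rw [hstar]
    simpa using hinv i (-A)
  · exact hcompress A x
  · simp only [hstar]
    rw [NormedSpace.star_exp, hA]
    exact hcompress (-A) x
end

section
/- Let m be an infinite cardinal and let A be an m-generated C*-algebra. Then there exist a complex Hilbert space H with Hilbert dimension exactly m and a faithful (injective) unital *-homomorphism ρ : A⁺ → B(H). -/
/- STATEMENT 10: an `m`-generated C*-algebra has a faithful unital representation of its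
unitization on a Hilbert space of Hilbert dimension exactly `m`. -/

open Cardinal

universe u

/-- A C*-algebra is `m`-generated if it is generated, as a C*-algebra (i.e. topologically),
by a set of cardinality at most `m`. -/
def MGenerated (m : Cardinal.{u}) (A : Type u) [NonUnitalCStarAlgebra A] : Prop :=
  ∃ G : Set A, #G ≤ m ∧ (NonUnitalStarAlgebra.adjoin ℂ G).topologicalClosure = ⊤

open scoped ComplexOrder

/-- The unitization of an `m`-generated C⋆-algebra, with `m` infinite, has a
dense subset of cardinality at most `m`. -/
theorem MGenerated.exists_dense_unitization {m : Cardinal.{u}} (hm : ℵ₀ ≤ m)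
    {A : Type u} [NonUnitalCStarAlgebra A] (h : MGenerated m A) :
    ∃ D : Set (Unitization ℂ A), #D ≤ m ∧ Dense D := by
  obtain ⟨G, hG, hGtop⟩ := h
  obtain ⟨Q, hQ, hQd⟩ := TopologicalSpace.exists_countable_dense ℂ
  let S : Set (Unitization ℂ A) :=
    (Unitization.inr '' (G ∪ star G)) ∪ algebraMap ℂ (Unitization ℂ A) '' Q
  let T := Algebra.adjoin ℤ S
  refine ⟨T, ?_, ?_⟩
  · have hGm : #(Unitization.inr '' (G ∪ star G) : Set (Unitization ℂ A)) ≤ m := by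
      refine mk_image_le.trans <| (mk_union_le _ _).trans <| add_le_of_le hm hG ?_
      rw [← Set.image_star]
      exact mk_image_le.trans hG
    have hQm : #(algebraMap ℂ (Unitization ℂ A) '' Q : Set (Unitization ℂ A)) ≤ m :=
      (hQ.image _).le_aleph0.trans hm
    refine (Algebra.lift_cardinalMk_adjoin_le ℤ S).trans' (by simp [T]) |>.trans ?_
    simp only [mk_int, lift_aleph0, lift_uzero]
    exact max_le (max_le hm ((mk_union_le _ _).trans (add_le_of_le hm hGm hQm))) hm
  · let K : Subring (Unitization ℂ A) := T.toSubring.topologicalClosure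
    have hTK : (T : Set (Unitization ℂ A)) ⊆ K := subset_closure
    have hSK : S ⊆ K := Algebra.subset_adjoin.trans hTK
    have hKc : IsClosed (K : Set (Unitization ℂ A)) := isClosed_closure
    have hscal (c : ℂ) : algebraMap ℂ (Unitization ℂ A) c ∈ K := by
      refine hQd.induction (P := fun c ↦ algebraMap ℂ (Unitization ℂ A) c ∈ K)
        (fun q hq ↦ hSK (Or.inr ⟨q, hq, rfl⟩))
        (hKc.preimage (algebraMapCLM ℂ (Unitization ℂ A)).continuous) c
    have hinr (a : A) : (a : Unitization ℂ A) ∈ K := by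
      have ha : a ∈ (NonUnitalStarAlgebra.adjoin ℂ G).topologicalClosure := hGtop ▸ trivial
      refine closure_minimal (s := (NonUnitalStarAlgebra.adjoin ℂ G : Set A))
        (t := Unitization.inr ⁻¹' (K : Set (Unitization ℂ A))) (fun x hx ↦ ?_)
        (hKc.preimage Unitization.isometry_inr.continuous) ha
      change x ∈ NonUnitalAlgebra.adjoin ℂ (G ∪ star G) at hx
      simp only [Set.mem_preimage, SetLike.mem_coe]
      induction hx using NonUnitalAlgebra.adjoin_induction with
      | mem x hx => exact hSK (Or.inl ⟨x, hx, rfl⟩)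
      | add x y _ _ hx hy => simpa using add_mem hx hy
      | zero => simp
      | mul x y _ _ hx hy => simpa using mul_mem hx hy
      | smul r x _ hx => simpa [Algebra.smul_def] using mul_mem (hscal r) hx
    intro x
    rw [← Unitization.inl_fst_add_inr_snd_eq x]
    exact add_mem (S := Subring (Unitization ℂ A)) (s := K) (hscal _) (hinr _)

/-- A positive functional that is strictly positive near a given positive element, with radius
the norm of that element. -/
theorem CStarAlgebra.exists_positiveLinearMap_pos_on_ball {B : Type*} [CStarAlgebra B]
    [PartialOrder B] [StarOrderedRing B] {d : B} (hd : 0 ≤ d) :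
    ∃ f : B →ₚ[ℂ] ℂ, ∀ x, 0 ≤ x → ‖x - d‖ < ‖d‖ → f x ≠ 0 := by
  have hdisj : Disjoint (Metric.ball (-d) ‖d‖) {x : B | 0 ≤ x} := by
    rw [Set.disjoint_left]
    intro x hx hx0
    rw [mem_ball_iff_norm, sub_neg_eq_add] at hx
    exact hx.not_ge (CStarAlgebra.norm_le_norm_of_nonneg_of_le hd
      (le_add_of_nonneg_left hx0))
  have hconv : Convex ℝ {x : B | 0 ≤ x} := fun x hx y hy a b ha hb _ ↦
    add_nonneg (smul_nonneg ha hx) (smul_nonneg hb hy)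
  obtain ⟨g, u, hgu, hug⟩ := RCLike.geometric_hahn_banach_open (𝕜 := ℂ)
    (convex_ball (-d) ‖d‖) Metric.isOpen_ball hconv hdisj
  have hu : u ≤ 0 := by simpa using hug 0 le_rfl
  have hg (x : B) (hx : 0 ≤ x) : 0 ≤ (g x).re := by
    by_contra! hneg
    have h := hug (((u - 1) / (g x).re) • x)
      (smul_nonneg (div_nonneg_of_nonpos (by linarith) hneg.le) hx)
    rw [← Complex.coe_smul, map_smul] at h
    simp only [smul_eq_mul, RCLike.re_eq_complex_re, Complex.re_ofReal_mul] at h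
    rw [div_mul_cancel₀ _ hneg.ne] at h
    linarith
  let φ : B →ₗ[ℂ] ℂ :=
    { toFun x := g x + star (g (star x))
      map_add' x y := by simp only [star_add, map_add]; ring
      map_smul' c x := by simp [mul_add] }
  have hφ (x : B) (hx : 0 ≤ x) : φ x = ((2 * (g x).re : ℝ) : ℂ) := by
    have : φ x = g x + star (g (star x)) := rfl
    rw [this, (IsSelfAdjoint.of_nonneg hx).star_eq]
    exact Complex.add_conj _
  refine ⟨.mk₀ φ fun x hx ↦ ?_, fun x hx hxd ↦ ?_⟩
  · rw [hφ x hx]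
    exact_mod_cast mul_nonneg zero_le_two (hg x hx)
  · change φ x ≠ 0
    rw [hφ x hx]
    have h := hgu (-x) (by rwa [mem_ball_iff_norm, neg_sub_neg, norm_sub_rev])
    simp only [map_neg, RCLike.re_eq_complex_re] at h
    have : (0 : ℝ) < 2 * (g x).re := by linarith
    exact_mod_cast this.ne'

/-- An orthonormal family injects into any dense set, in the sense of cardinality. -/
theorem Orthonormal.cardinalMk_le_of_dense {E : Type u} [NormedAddCommGroup E]
    [InnerProductSpace ℂ E] {κ : Type u} {v : κ → E} (hv : Orthonormal ℂ v)
    {X : Type u} {j : X → E} (hj : DenseRange j) : #κ ≤ #X := by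
  choose c hc using fun k ↦ hj.exists_dist_lt (v k) (show (0 : ℝ) < 1 / 2 by norm_num)
  refine mk_le_of_injective (f := c) fun k l hkl ↦ ?_
  by_contra hne
  have h1 : ‖v k - v l‖ ^ 2 = 2 := by
    rw [@norm_sub_sq ℂ, hv.2 hne, hv.1, hv.1]; norm_num
  have h2 : ‖v k - v l‖ < 1 := by
    rw [← dist_eq_norm]
    have hk := hc k
    rw [hkl] at hk
    linarith [dist_triangle_right (v k) (v l) (j (c l)), hc l]
  nlinarith [norm_nonneg (v k - v l)]

theorem PositiveLinearMap.denseRange_gnsStarAlgHom_apply_one {B : Type*} [CStarAlgebra B]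
    [PartialOrder B] [StarOrderedRing B] (f : B →ₚ[ℂ] ℂ) :
    DenseRange fun b ↦ f.gnsStarAlgHom b (f.toPreGNS 1 : f.GNS) := by
  have : (fun b ↦ f.gnsStarAlgHom b (f.toPreGNS 1 : f.GNS)) =
      (fun x : f.PreGNS ↦ (x : f.GNS)) ∘ f.toPreGNS := by
    ext b
    change f.gnsNonUnitalStarAlgHom b (f.toPreGNS 1 : f.GNS) = _
    simp
  rw [this]
  exact UniformSpace.Completion.denseRange_coe.comp f.toPreGNS.surjective.denseRange
    (UniformSpace.Completion.continuous_coe _)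

theorem PositiveLinearMap.gnsStarAlgHom_ne_zero {B : Type*} [CStarAlgebra B]
    [PartialOrder B] [StarOrderedRing B] (f : B →ₚ[ℂ] ℂ) {b : B} (hb : f (star b * b) ≠ 0) :
    f.gnsStarAlgHom b ≠ 0 := by
  intro h
  apply hb
  have h1 : f.gnsNonUnitalStarAlgHom b (f.toPreGNS 1 : f.GNS) = 0 :=
    DFunLike.congr_fun h (f.toPreGNS 1 : f.GNS)
  rw [gnsNonUnitalStarAlgHom_apply_coe] at h1
  have h2 : ‖f.toPreGNS b‖ = 0 := by
    have h3 := congrArg norm h1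
    rw [UniformSpace.Completion.norm_coe, norm_zero] at h3
    simpa using h3
  simpa [h2] using (f.preGNS_norm_sq (f.toPreGNS b)).symm

/-- The Hilbert basis of a Hilbert sum obtained by collecting Hilbert bases of the summands. -/
theorem lp.exists_hilbertBasis_sigma {ι : Type*} {E : ι → Type*}
    [∀ i, NormedAddCommGroup (E i)] [∀ i, InnerProductSpace ℂ (E i)] [∀ i, CompleteSpace (E i)]
    {κ : ι → Type*} (b : ∀ i, HilbertBasis (κ i) ℂ (E i)) :
    Nonempty (HilbertBasis (Σ i, κ i) ℂ (lp E 2)) := by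
  classical
  let V (i : ι) : E i →ₗᵢ[ℂ] lp E 2 :=
    { lp.singleContinuousLinearMap ℂ E 2 i with
      norm_map' := fun x ↦ lp.norm_single (by norm_num) i x }
  have hV (i : ι) (x : E i) : V i x = lp.single 2 i x := rfl
  have hortho : OrthogonalFamily ℂ E V := by
    intro i j hij x y
    rw [hV, hV, lp.inner_single_left, lp.single_apply_ne _ _ _ hij, inner_zero_right]
  refine ⟨HilbertBasis.mk
    (hortho.orthonormal_sigma_orthonormal fun i ↦ (b i).orthonormal) ?_⟩
  intro x _
  set P := (Submodule.span ℂ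
    (Set.range fun a : Σ i, κ i ↦ V a.1 (b a.1 a.2))).topologicalClosure with hP
  have hPc : IsClosed (P : Set (lp E 2)) := Submodule.isClosed_topologicalClosure _
  have hsingle (i : ι) (y : E i) : V i y ∈ P := by
    have hy : y ∈ (Submodule.span ℂ (Set.range (b i))).topologicalClosure := by
      rw [(b i).dense_span]; trivial
    refine closure_minimal (t := V i ⁻¹' (P : Set (lp E 2))) ?_
      (hPc.preimage (V i).continuous) hy
    change Submodule.span ℂ (Set.range (b i)) ≤ P.comap (V i).toLinearMap
    rw [Submodule.span_le]
    rintro _ ⟨k, rfl⟩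
    exact Submodule.le_topologicalClosure _ (Submodule.subset_span ⟨⟨i, k⟩, rfl⟩)
  exact hPc.mem_of_tendsto (lp.hasSum_single (by norm_num) x)
    (.of_forall fun s ↦ P.sum_mem fun i _ ↦ hsingle i (x i))

/-- The direct sum of a family of unital representations of a C⋆-algebra. -/
noncomputable def StarAlgHom.lpSum {B : Type*} [CStarAlgebra B] {ι : Type*} {E : ι → Type*}
    [∀ i, NormedAddCommGroup (E i)] [∀ i, InnerProductSpace ℂ (E i)] [∀ i, CompleteSpace (E i)]
    (π : ∀ i, B →⋆ₐ[ℂ] (E i →L[ℂ] E i)) : B →⋆ₐ[ℂ] (lp E 2 →L[ℂ] lp E 2) where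
  toFun b := lp.mapCLM 2 (fun i ↦ π i b) (norm_nonneg b)
    fun i ↦ NonUnitalStarAlgHom.norm_apply_le (π i) b
  map_one' := by ext; simp
  map_mul' _ _ := by ext; simp
  map_zero' := by ext; simp
  map_add' _ _ := by ext; simp
  commutes' c := by ext; simp [Algebra.algebraMap_eq_smul_one]
  map_star' b := by
    rw [ContinuousLinearMap.star_eq_adjoint, ContinuousLinearMap.eq_adjoint_iff]
    intro x y
    simp [lp.inner_eq_tsum, map_star, ContinuousLinearMap.star_eq_adjoint,
      ContinuousLinearMap.adjoint_inner_left]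

theorem StarAlgHom.lpSum_apply {B : Type*} [CStarAlgebra B] {ι : Type*} {E : ι → Type*}
    [∀ i, NormedAddCommGroup (E i)] [∀ i, InnerProductSpace ℂ (E i)] [∀ i, CompleteSpace (E i)]
    (π : ∀ i, B →⋆ₐ[ℂ] (E i →L[ℂ] E i)) (b : B) (x : lp E 2) (i : ι) :
    StarAlgHom.lpSum π b x i = π i b (x i) := rfl

theorem StarAlgHom.lpSum_injective {B : Type*} [CStarAlgebra B] {ι : Type*} {E : ι → Type*}
    [∀ i, NormedAddCommGroup (E i)] [∀ i, InnerProductSpace ℂ (E i)] [∀ i, CompleteSpace (E i)]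
    (π : ∀ i, B →⋆ₐ[ℂ] (E i →L[ℂ] E i)) (h : ∀ b ≠ 0, ∃ i, π i b ≠ 0) :
    Function.Injective (StarAlgHom.lpSum π) := by
  classical
  rw [injective_iff_map_eq_zero]
  intro b hb
  by_contra hb0
  obtain ⟨i, hi⟩ := h b hb0
  refine hi (ContinuousLinearMap.ext fun x ↦ ?_)
  have := StarAlgHom.lpSum_apply π b (lp.single 2 i x) i
  rw [hb] at this
  simpa using this.symm

/-- A nontrivial unital C⋆-algebra with a dense subset of infinite cardinality at most `m` is
faithfully represented on a Hilbert space of Hilbert dimension `m`. -/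
theorem CStarAlgebra.exists_faithful_representation_of_dense {m : Cardinal.{u}} (hm : ℵ₀ ≤ m)
    {B : Type u} [CStarAlgebra B] [Nontrivial B] {D : Set B} (hDm : #D ≤ m) (hD : Dense D) :
    ∃ (H : Type u) (_ : NormedAddCommGroup H) (_ : InnerProductSpace ℂ H)
      (_ : CompleteSpace H) (ι : Type u) (_ : HilbertBasis ι ℂ H),
      #ι = m ∧ ∃ ρ : B →⋆ₐ[ℂ] (H →L[ℂ] H), Function.Injective ρ := by
  let _ := CStarAlgebra.spectralOrder B
  let _ := CStarAlgebra.spectralOrderedRing B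
  choose f hf using fun d : D ↦
    CStarAlgebra.exists_positiveLinearMap_pos_on_ball (star_mul_self_nonneg (d : B))
  have hsep (b : B) (hb : b ≠ 0) : ∃ d : D, (f d).gnsStarAlgHom b ≠ 0 := by
    have hpos : 0 < ‖star b * b‖ := norm_pos_iff.2 (CStarRing.star_mul_self_ne_zero_iff b |>.2 hb)
    have hopen : IsOpen {x : B | ‖star b * b - star x * x‖ < ‖star x * x‖} :=
      isOpen_lt (by fun_prop) (by fun_prop)
    obtain ⟨d, hd, hdD⟩ := hD.inter_open_nonempty _ hopen ⟨b, by simpa using hpos⟩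
    exact ⟨⟨d, hdD⟩, (f ⟨d, hdD⟩).gnsStarAlgHom_ne_zero
      (hf ⟨d, hdD⟩ _ (star_mul_self_nonneg b) hd)⟩
  choose w b _ using fun d : D ↦ exists_hilbertBasis ℂ (f d).GNS
  have hw (d : D) : #(w d) ≤ m := by
    refine ((b d).orthonormal.cardinalMk_le_of_dense (X := D)
      (j := fun x ↦ (f d).gnsStarAlgHom (x : B) ((f d).toPreGNS 1 : (f d).GNS)) ?_).trans hDm
    refine (f d).denseRange_gnsStarAlgHom_apply_one.comp hD.denseRange_val ?_
    have : Continuous (f d).gnsStarAlgHom := map_continuous _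
    fun_prop
  obtain ⟨d₀, hd₀⟩ := hsep 1 one_ne_zero
  have hw₀ : Nonempty (w d₀) := by
    by_contra hempty
    rw [not_nonempty_iff] at hempty
    refine hd₀ (ContinuousLinearMap.ext fun x ↦ (b d₀).repr.injective ?_)
    ext i
    exact isEmptyElim i
  let ι := D × m.out
  obtain ⟨c⟩ := lp.exists_hilbertBasis_sigma (fun i : ι ↦ b i.1)
  refine ⟨lp (fun i : ι ↦ (f i.1).GNS) 2, inferInstance, inferInstance, inferInstance, _, c,
    le_antisymm ?_ ?_, StarAlgHom.lpSum fun i : ι ↦ (f i.1).gnsStarAlgHom,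
    StarAlgHom.lpSum_injective _ fun x hx ↦ ?_⟩
  · have hι : #ι ≤ m := by
      simpa [ι] using mul_le_of_le hm hDm le_rfl
    rw [mk_sigma]
    exact (sum_le_sum _ _ fun i : ι ↦ hw i.1).trans (by simpa using mul_le_of_le hm hι le_rfl)
  · obtain ⟨k⟩ := hw₀
    refine (mk_out m).ge.trans <| mk_le_of_injective (f := fun x ↦ (⟨(d₀, x), k⟩ : Σ i : ι, w i.1)) fun x y hxy ↦ ?_
    exact congrArg (fun z ↦ z.1.2) hxy
  · obtain ⟨d, hd⟩ := hsep x hx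
    have hne : Nonempty m.out := by
      rw [← mk_ne_zero_iff, mk_out]
      exact (aleph0_pos.trans_le hm).ne'
    exact ⟨(d, hne.some), hd⟩

theorem stmt_10 (m : Cardinal.{u}) (hm : ℵ₀ ≤ m)
    (A : Type u) [NonUnitalCStarAlgebra A] (hgen : MGenerated m A) :
    ∃ (H : Type u) (_ : NormedAddCommGroup H) (_ : InnerProductSpace ℂ H)
      (_ : CompleteSpace H) (ι : Type u) (_ : HilbertBasis ι ℂ H),
      #ι = m ∧
      ∃ ρ : Unitization ℂ A →⋆ₐ[ℂ] (H →L[ℂ] H), Function.Injective ρ := by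
  obtain ⟨D, hDm, hD⟩ := hgen.exists_dense_unitization hm
  exact CStarAlgebra.exists_faithful_representation_of_dense hm hDm hD
end
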